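/- arXiv:math/0204150 — 4 statements merged into one kernel-verified Lean document; each statement's English description precedes it below -/
import Mathlib

section
/- Let m, n ≥ 1 be integers and let p be a real number with p > m and p > n. Suppose (u_k) is a sequence of continuously differentiable functions u_k : ℝ^m × ℝ^n → ℝ and R ≥ 0 is a constant such that ∫_{B₂ × N} (|u_k(x,y)|^p + ‖Du_k(x,y)‖^p) d(x,y) ≤ R for all k. Then there exists a strictly increasing map φ : ℕ → ℕ such that the subsequence (u_{φ(k)}) is uniformly Cauchy in L^p(N) over B₁: for every ε > 0 there is K ∈ ℕ such that for all i, j ≥ K and every x ∈ B₁ one has ∫_N |u_{φ(i)}(x,y) − u_{φ(j)}(x,y)|^p dy ≤ ε. -/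
open MeasureTheory Metric
open Set Filter Topology
open scoped ENNReal

theorem setLIntegral_comp_smul_add_le {E : Type*} [NormedAddCommGroup E] [NormedSpace ℝ E]
    [FiniteDimensional ℝ E] [MeasurableSpace E] [BorelSpace E]
    (μ : Measure E) [μ.IsAddHaarMeasure] {K : Set E} (hK : MeasurableSet K) {a : ℝ} (ha : 0 < a)
    {b : E} (hab : ∀ y ∈ K, a • y + b ∈ K) (h : E → ℝ≥0∞) :
    ∫⁻ y in K, h (a • y + b) ∂μ ≤
      ENNReal.ofReal ((a ^ Module.finrank ℝ E)⁻¹) * ∫⁻ y in K, h y ∂μ := by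
  have hscale (f : E → ℝ≥0∞) : ∫⁻ y, f (a • y) ∂μ =
      ENNReal.ofReal ((a ^ Module.finrank ℝ E)⁻¹) * ∫⁻ y, f y ∂μ := by
    have hmap := lintegral_map_equiv (μ := μ) f
      (Homeomorph.smulOfNeZero a ha.ne' : E ≃ₜ E).toMeasurableEquiv
    have hm : Measure.map (Homeomorph.smulOfNeZero a ha.ne' : E ≃ₜ E).toMeasurableEquiv μ =
        ENNReal.ofReal (abs (a ^ Module.finrank ℝ E)⁻¹) • μ :=
      Measure.map_addHaar_smul μ ha.ne'
    rw [hm, lintegral_smul_measure, abs_of_nonneg (by positivity)] at hmap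
    exact hmap.symm
  rw [← lintegral_indicator hK, ← lintegral_indicator hK]
  calc ∫⁻ y, K.indicator (fun y => h (a • y + b)) y ∂μ
      ≤ ∫⁻ y, (fun z => K.indicator h (z + b)) (a • y) ∂μ := by
        refine lintegral_mono fun y => ?_
        by_cases hy : y ∈ K
        · simp [hy, hab y hy]
        · simp [hy]
    _ = _ := by
        rw [hscale fun z => K.indicator h (z + b), lintegral_add_right_eq_self]

/-- Jensen's inequality for the `p`-th power of the norm of an average. -/
theorem enorm_integral_rpow_le_lintegral {α : Type*} [MeasurableSpace α] (P : Measure α)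
    [IsProbabilityMeasure P] {f : α → ℝ} (hf : AEStronglyMeasurable f P) {p : ℝ} (hp : 1 ≤ p) :
    ‖∫ a, f a ∂P‖ₑ ^ p ≤ ∫⁻ a, ‖f a‖ₑ ^ p ∂P := by
  have hp0 : 0 < p := by linarith
  have h := eLpNorm'_le_eLpNorm'_of_exponent_le one_pos hp P hf
  simp only [eLpNorm', ENNReal.rpow_one, div_one] at h
  calc ‖∫ a, f a ∂P‖ₑ ^ p ≤ ((∫⁻ a, ‖f a‖ₑ ^ p ∂P) ^ (1 / p)) ^ p := by
        gcongr
        exact (enorm_integral_le_lintegral_enorm f).trans h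
    _ = _ := by rw [← ENNReal.rpow_mul, one_div_mul_cancel hp0.ne', ENNReal.rpow_one]

/-- An increment of a `C¹` function, bounded through its derivative along the segment from `a` to
`b`, which is traversed as `τ ↦ a + τ ^ (k + 1) • (b - a)`. -/
theorem enorm_sub_rpow_le_lintegral_fderiv {G : Type*} [NormedAddCommGroup G] [NormedSpace ℝ G]
    {u : G → ℝ} (hu : ContDiff ℝ 1 u) {p : ℝ} (hp : 1 ≤ p) (k : ℕ) (a b : G) :
    ‖u b - u a‖ₑ ^ p ≤ ENNReal.ofReal ((k + 1) * ‖b - a‖) ^ p *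
      ∫⁻ τ in Ioc (0 : ℝ) 1, ENNReal.ofReal (τ ^ k) ^ p *
        ‖fderiv ℝ u (a + τ ^ (k + 1) • (b - a))‖ₑ ^ p := by
  have hp0 : 0 ≤ p := by linarith
  have hfd : Continuous (fderiv ℝ u) := hu.continuous_fderiv one_ne_zero
  set f' : ℝ → ℝ := fun τ =>
    fderiv ℝ u (a + τ ^ (k + 1) • (b - a)) ((((k + 1 : ℕ) : ℝ) * τ ^ k) • (b - a)) with hf'
  have hcont : Continuous f' := by fun_prop
  have hderiv (τ : ℝ) : HasDerivAt (fun τ : ℝ => u (a + τ ^ (k + 1) • (b - a))) (f' τ) τ := by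
    have h1 : HasDerivAt (fun τ : ℝ => a + τ ^ (k + 1) • (b - a))
        ((((k + 1 : ℕ) : ℝ) * τ ^ k) • (b - a)) τ := by
      simpa using ((hasDerivAt_pow (k + 1) τ).smul_const (b - a)).const_add a
    exact ((hu.differentiable one_ne_zero _).hasFDerivAt).comp_hasDerivAt τ h1
  have hftc := intervalIntegral.integral_eq_sub_of_hasDerivAt (a := 0) (b := 1)
    (fun τ _ => hderiv τ) (hcont.intervalIntegrable 0 1)
  simp only [one_pow, one_smul, add_sub_cancel, ne_eq, Nat.add_eq_zero_iff, one_ne_zero, and_false,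
    not_false_eq_true, zero_pow, zero_smul, add_zero] at hftc
  rw [intervalIntegral.integral_of_le zero_le_one] at hftc
  have : IsProbabilityMeasure (volume.restrict (Ioc (0 : ℝ) 1)) := ⟨by simp⟩
  rw [← hftc, ← lintegral_const_mul' _ _
    (ENNReal.rpow_ne_top_of_nonneg hp0 ENNReal.ofReal_ne_top)]
  refine (enorm_integral_rpow_le_lintegral _ hcont.aestronglyMeasurable hp).trans ?_
  refine setLIntegral_mono' measurableSet_Ioc fun τ hτ => ?_
  rw [← ENNReal.mul_rpow_of_nonneg _ _ hp0, ← ENNReal.mul_rpow_of_nonneg _ _ hp0]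
  gcongr
  have hτ0 : 0 ≤ τ := hτ.1.le
  rw [← ofReal_norm, ← ofReal_norm, ← ENNReal.ofReal_mul (by positivity),
    ← ENNReal.ofReal_mul (by positivity)]
  apply ENNReal.ofReal_le_ofReal
  refine (ContinuousLinearMap.le_opNorm _ _).trans (le_of_eq ?_)
  rw [norm_smul, Real.norm_of_nonneg (by positivity)]
  push_cast
  ring

section
variable {E F : Type*} [NormedAddCommGroup E] [NormedSpace ℝ E] [FiniteDimensional ℝ E]
  [MeasurableSpace E] [BorelSpace E] [NormedAddCommGroup F] [NormedSpace ℝ F]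
  [FiniteDimensional ℝ F] [MeasurableSpace F] [BorelSpace F]

theorem lintegral_lintegral_comp_lineMap_le (μ : Measure E) [μ.IsAddHaarMeasure] (ν : Measure F)
    [ν.IsAddHaarMeasure] {A : Set E} {B : Set F} (hA : Convex ℝ A) (hB : Convex ℝ B)
    (hAm : MeasurableSet A) (hBm : MeasurableSet B) {g : E × F → ℝ≥0∞} (hg : Measurable g)
    {x : E} (hx : x ∈ A) {t : ℝ} (ht0 : 0 < t) (ht1 : t < 1) :
    ∫⁻ y in B, ∫⁻ w in A ×ˢ B, g ((1 - t) • (x, y) + t • w) ∂(μ.prod ν) ∂ν ≤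
      ENNReal.ofReal ((t ^ Module.finrank ℝ E)⁻¹) *
        (ENNReal.ofReal (((1 - t) ^ Module.finrank ℝ F)⁻¹) * (ν B *
          ∫⁻ w in A ×ˢ B, g w ∂(μ.prod ν))) := by
  have ht1' : 0 < 1 - t := by linarith
  set H : F → ℝ≥0∞ := fun v => ∫⁻ w in A, g (w, v) ∂μ with hH
  have hHm : Measurable H := hg.lintegral_prod_left'
  have hmeas (y : F) : Measurable fun w : E × F => g ((1 - t) • (x, y) + t • w) :=
    hg.comp (by fun_prop)
  have hHB : ∫⁻ w in A ×ˢ B, g w ∂(μ.prod ν) = ∫⁻ v in B, H v ∂ν :=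
    setLIntegral_prod_symm _ hg.aemeasurable
  calc ∫⁻ y in B, ∫⁻ w in A ×ˢ B, g ((1 - t) • (x, y) + t • w) ∂(μ.prod ν) ∂ν
      ≤ ∫⁻ y in B, ENNReal.ofReal ((t ^ Module.finrank ℝ E)⁻¹) *
          ∫⁻ v in B, H ((1 - t) • y + t • v) ∂ν ∂ν := by
        refine lintegral_mono fun y => ?_
        rw [setLIntegral_prod_symm _ (hmeas y).aemeasurable, ← lintegral_const_mul' _ _ (by simp)]
        refine lintegral_mono fun v => ?_
        have h := setLIntegral_comp_smul_add_le μ hAm ht0 (b := (1 - t) • x)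
          (fun w hw => by
            rw [add_comm]; exact hA hx hw ht1'.le ht0.le (by ring))
          (fun w => g (w, (1 - t) • y + t • v))
        simpa [Prod.smul_mk, add_comm] using h
    _ = ENNReal.ofReal ((t ^ Module.finrank ℝ E)⁻¹) *
          ∫⁻ v in B, ∫⁻ y in B, H ((1 - t) • y + t • v) ∂ν ∂ν := by
        rw [lintegral_const_mul' _ _ (by simp), lintegral_lintegral_swap]
        exact (hHm.comp (by fun_prop : Measurable fun q : F × F =>
          (1 - t) • q.1 + t • q.2)).aemeasurable
    _ ≤ ENNReal.ofReal ((t ^ Module.finrank ℝ E)⁻¹) *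
          ∫⁻ v in B, ENNReal.ofReal (((1 - t) ^ Module.finrank ℝ F)⁻¹) * ∫⁻ y in B, H y ∂ν ∂ν := by
        refine mul_le_mul' le_rfl (setLIntegral_mono' hBm fun v hv => ?_)
        exact setLIntegral_comp_smul_add_le ν hBm ht1'
          (fun y hy => hB hy hv ht1'.le ht0.le (by ring)) H
    _ = _ := by
        rw [setLIntegral_const, hHB]; ring
/-- The average over `w ∈ D` of the values of `u` at the points `(1 - s) • z + s • w`. -/
noncomputable def dilatedAverage {G : Type*} [NormedAddCommGroup G] [NormedSpace ℝ G]
    [MeasurableSpace G] (ρ : Measure G) (D : Set G) (s : ℝ) (u : G → ℝ) (z : G) : ℝ :=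
  ∫ w, u ((1 - s) • z + s • w) ∂(ProbabilityTheory.cond ρ D)

section
variable {G : Type*} [NormedAddCommGroup G] [NormedSpace ℝ G] [FiniteDimensional ℝ G]
  [MeasurableSpace G] [BorelSpace G] {ρ : Measure G} [ρ.IsAddHaarMeasure] {D : Set G}

theorem integrable_cond_of_continuous {X : Type*} [TopologicalSpace X] [T2Space X]
    [MeasurableSpace X] [BorelSpace X] {ρ : Measure X} [IsFiniteMeasureOnCompacts ρ] {D : Set X}
    (hD : IsCompact D) (hρ : ρ D ≠ 0) {f : X → ℝ} (hf : Continuous f) :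
    Integrable f (ProbabilityTheory.cond ρ D) :=
  Integrable.smul_measure (hf.continuousOn.integrableOn_compact hD) (by simpa using hρ)

theorem lintegral_cond_comp_lineMap_le (hDm : MeasurableSet D) (hDc : Convex ℝ D) {s : ℝ}
    (hs0 : 0 < s) (hs1 : s < 1) {z : G} (hz : z ∈ D) (g : G → ℝ≥0∞) :
    ∫⁻ w, g ((1 - s) • z + s • w) ∂(ProbabilityTheory.cond ρ D) ≤
      (ρ D)⁻¹ * (ENNReal.ofReal ((s ^ Module.finrank ℝ G)⁻¹) * ∫⁻ w in D, g w ∂ρ) := by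
  rw [ProbabilityTheory.cond, lintegral_smul_measure, smul_eq_mul]
  refine mul_le_mul' le_rfl ?_
  have h := setLIntegral_comp_smul_add_le ρ hDm hs0 (b := (1 - s) • z)
    (fun w hw => by
      rw [add_comm]; exact hDc hz hw (by linarith) hs0.le (by ring)) g
  simpa [add_comm] using h

theorem enorm_dilatedAverage_rpow_le (hD : IsCompact D) (hDc : Convex ℝ D) (hρ : ρ D ≠ 0)
    {s : ℝ} (hs0 : 0 < s) (hs1 : s < 1) {p : ℝ} (hp : 1 ≤ p) {u : G → ℝ} (hu : Continuous u)
    {z : G} (hz : z ∈ D) :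
    ‖dilatedAverage ρ D s u z‖ₑ ^ p ≤ (ρ D)⁻¹ *
      (ENNReal.ofReal ((s ^ Module.finrank ℝ G)⁻¹) * ∫⁻ w in D, ‖u w‖ₑ ^ p ∂ρ) := by
  have := ProbabilityTheory.cond_isProbabilityMeasure_of_finite hρ hD.measure_ne_top
  refine (enorm_integral_rpow_le_lintegral _ ?_ hp).trans
    (lintegral_cond_comp_lineMap_le hD.measurableSet hDc hs0 hs1 hz (fun w => ‖u w‖ₑ ^ p))
  exact (by fun_prop : Continuous fun w => u ((1 - s) • z + s • w)).aestronglyMeasurable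

/-- The dilated average is Lipschitz on `D`, with a constant controlled by the `L^p` norm of the
derivative. -/
theorem enorm_dilatedAverage_sub_rpow_le (hD : IsCompact D) (hDc : Convex ℝ D) (hρ : ρ D ≠ 0)
    {s : ℝ} (hs0 : 0 < s) (hs1 : s < 1) {p : ℝ} (hp : 1 ≤ p) {u : G → ℝ} (hu : ContDiff ℝ 1 u)
    {z z' : G} (hz : z ∈ D) (hz' : z' ∈ D) :
    ‖dilatedAverage ρ D s u z' - dilatedAverage ρ D s u z‖ₑ ^ p ≤
      ENNReal.ofReal ‖z' - z‖ ^ p * ((ρ D)⁻¹ *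
        (ENNReal.ofReal ((s ^ Module.finrank ℝ G)⁻¹) *
          ∫⁻ w in D, ‖fderiv ℝ u w‖ₑ ^ p ∂ρ)) := by
  have := ProbabilityTheory.cond_isProbabilityMeasure_of_finite hρ hD.measure_ne_top
  have hp0 : 0 ≤ p := by linarith
  have huc := hu.continuous
  have hfd : Continuous (fderiv ℝ u) := hu.continuous_fderiv one_ne_zero
  have hc (z : G) : Continuous fun w => u ((1 - s) • z + s • w) := by fun_prop
  set P := ProbabilityTheory.cond ρ D with hP
  set g : G → ℝ≥0∞ := fun w => ‖fderiv ℝ u w‖ₑ ^ p with hg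
  have hgm : Measurable g := by fun_prop
  rw [dilatedAverage, dilatedAverage, ← integral_sub (integrable_cond_of_continuous hD hρ (hc z'))
    (integrable_cond_of_continuous hD hρ (hc z))]
  calc _ ≤ ∫⁻ w, ‖u ((1 - s) • z' + s • w) - u ((1 - s) • z + s • w)‖ₑ ^ p ∂P :=
        enorm_integral_rpow_le_lintegral _ ((hc z').sub (hc z)).aestronglyMeasurable hp
    _ ≤ ∫⁻ w, ENNReal.ofReal ‖z' - z‖ ^ p * ∫⁻ τ in Ioc (0 : ℝ) 1,
          g ((1 - s) • (z + τ • (z' - z)) + s • w) ∂volume ∂P := by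
        refine lintegral_mono fun w => ?_
        refine (enorm_sub_rpow_le_lintegral_fderiv hu hp 0 _ _).trans ?_
        have h1 : (1 - s) • z' + s • w - ((1 - s) • z + s • w) = (1 - s) • (z' - z) := by module
        gcongr
        · rw [h1, norm_smul, Real.norm_of_nonneg (by linarith)]
          simp only [Nat.cast_zero, zero_add, one_mul]
          exact mul_le_of_le_one_left (norm_nonneg _) (by linarith)
        · rename_i τ
          have h2 : (1 - s) • z + s • w + τ ^ (0 + 1) • ((1 - s) • (z' - z)) =
            (1 - s) • (z + τ • (z' - z)) + s • w := by simp only [zero_add, pow_one]; module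
          rw [h1, h2]
          simp [hg]
    _ = ENNReal.ofReal ‖z' - z‖ ^ p * ∫⁻ τ in Ioc (0 : ℝ) 1,
          ∫⁻ w, g ((1 - s) • (z + τ • (z' - z)) + s • w) ∂P := by
        rw [lintegral_const_mul' _ _ (ENNReal.rpow_ne_top_of_nonneg hp0 ENNReal.ofReal_ne_top),
          lintegral_lintegral_swap]
        exact (hgm.comp (by fun_prop : Measurable fun q : G × ℝ =>
          (1 - s) • (z + q.2 • (z' - z)) + s • q.1)).aemeasurable
    _ ≤ ENNReal.ofReal ‖z' - z‖ ^ p * ∫⁻ τ in Ioc (0 : ℝ) 1, ((ρ D)⁻¹ *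
        (ENNReal.ofReal ((s ^ Module.finrank ℝ G)⁻¹) * ∫⁻ w in D, g w ∂ρ)) := by
        refine mul_le_mul' le_rfl (setLIntegral_mono' measurableSet_Ioc fun τ hτ => ?_)
        refine lintegral_cond_comp_lineMap_le hD.measurableSet hDc hs0 hs1 ?_ g
        exact hDc.add_smul_sub_mem hz hz' ⟨hτ.1.le, hτ.2⟩
    _ = _ := by simp
end

/-- Morrey type estimate: on every slice `{x} × B` a `C¹` function is `L^p`-close to its dilated
average, with an error of order `s ^ (p - dim E)`. -/
theorem lintegral_sub_dilatedAverage_rpow_le {μ : Measure E} [μ.IsAddHaarMeasure] {ν : Measure F}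
    [ν.IsAddHaarMeasure] {A : Set E} {B : Set F} (hA : IsCompact A) (hB : IsCompact B)
    (hAc : Convex ℝ A) (hBc : Convex ℝ B) (hρ : (μ.prod ν) (A ×ˢ B) ≠ 0)
    {d : ℝ} (hd : ∀ z ∈ A ×ˢ B, ∀ w ∈ A ×ˢ B, ‖w - z‖ ≤ d)
    {p : ℝ} (hp : 1 ≤ p) {k : ℕ} (hk : ((k + 1) * Module.finrank ℝ E : ℝ) ≤ k * p)
    {u : E × F → ℝ} (hu : ContDiff ℝ 1 u) {s : ℝ} (hs0 : 0 < s) (hs1 : s ≤ 1 / 2)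
    {x : E} (hx : x ∈ A) :
    ∫⁻ y in B, ‖dilatedAverage (μ.prod ν) (A ×ˢ B) s u (x, y) - u (x, y)‖ₑ ^ p ∂ν ≤
      ENNReal.ofReal (s ^ (p - Module.finrank ℝ E)) *
      (((μ.prod ν) (A ×ˢ B))⁻¹ * (ENNReal.ofReal ((k + 1) * d) ^ p *
        (ENNReal.ofReal (2 ^ Module.finrank ℝ F) *
        (ν B * ∫⁻ w in A ×ˢ B, ‖fderiv ℝ u w‖ₑ ^ p ∂(μ.prod ν))))) := by
  set D := A ×ˢ B with hDdef
  set ρ := μ.prod ν with hρdef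
  set M := Module.finrank ℝ E with hM
  set N := Module.finrank ℝ F with hN
  have hD : IsCompact D := hA.prod hB
  have := ProbabilityTheory.cond_isProbabilityMeasure_of_finite hρ hD.measure_ne_top
  have hp0 : 0 ≤ p := by linarith
  have huc := hu.continuous
  have hfd : Continuous (fderiv ℝ u) := hu.continuous_fderiv one_ne_zero
  set P := ProbabilityTheory.cond ρ D with hP
  set g : E × F → ℝ≥0∞ := fun w => ‖fderiv ℝ u w‖ₑ ^ p with hg
  have hgm : Measurable g := by fun_prop
  have hc (z : E × F) : Continuous fun w => u ((1 - s) • z + s • w) := by fun_prop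
  have hK : ENNReal.ofReal ((k + 1) * (s * d)) ^ p ≠ ∞ :=
    ENNReal.rpow_ne_top_of_nonneg hp0 ENNReal.ofReal_ne_top
  obtain ⟨y₀, hy₀⟩ : B.Nonempty := by
    by_contra h
    rw [not_nonempty_iff_eq_empty] at h
    simp [hDdef, h] at hρ
  have hd0 : 0 ≤ d := (norm_nonneg _).trans (hd (x, y₀) ⟨hx, hy₀⟩ (x, y₀) ⟨hx, hy₀⟩)
  have hjm : Measurable fun q : F × (E × F) × ℝ => ENNReal.ofReal (q.2.2 ^ k) ^ p *
      g ((1 - s * q.2.2 ^ (k + 1)) • (x, q.1) + (s * q.2.2 ^ (k + 1)) • q.2.1) := by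
    refine Measurable.mul (by fun_prop) (hgm.comp ?_)
    exact (by fun_prop : Continuous fun q : F × (E × F) × ℝ =>
      (1 - s * q.2.2 ^ (k + 1)) • (x, q.1) + (s * q.2.2 ^ (k + 1)) • q.2.1).measurable
  calc ∫⁻ y in B, ‖dilatedAverage ρ D s u (x, y) - u (x, y)‖ₑ ^ p ∂ν
      ≤ ∫⁻ y in B, ∫⁻ w, ‖u ((1 - s) • (x, y) + s • w) - u (x, y)‖ₑ ^ p ∂P ∂ν := by
        refine lintegral_mono fun y => ?_
        have h : dilatedAverage ρ D s u (x, y) - u (x, y) =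
            ∫ w, (u ((1 - s) • (x, y) + s • w) - u (x, y)) ∂P := by
          rw [integral_sub (integrable_cond_of_continuous hD hρ (hc _)) (integrable_const _)]
          simp [dilatedAverage]
        dsimp only
        rw [h]
        exact enorm_integral_rpow_le_lintegral _
          ((hc _).sub continuous_const).aestronglyMeasurable hp
    _ = (ρ D)⁻¹ * ∫⁻ y in B, ∫⁻ w in D, ‖u ((1 - s) • (x, y) + s • w) - u (x, y)‖ₑ ^ p ∂ρ ∂ν := by
        simp_rw [hP, ProbabilityTheory.cond, lintegral_smul_measure, smul_eq_mul]
        rw [lintegral_const_mul' _ _ (by simpa using hρ)]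
    _ ≤ (ρ D)⁻¹ * ∫⁻ y in B, ∫⁻ w in D, ENNReal.ofReal ((k + 1) * (s * d)) ^ p *
          ∫⁻ τ in Ioc (0 : ℝ) 1, ENNReal.ofReal (τ ^ k) ^ p *
            g ((1 - s * τ ^ (k + 1)) • (x, y) + (s * τ ^ (k + 1)) • w) ∂volume ∂ρ ∂ν := by
        refine mul_le_mul' le_rfl (setLIntegral_mono' hB.measurableSet fun y hy =>
          setLIntegral_mono' hD.measurableSet fun w hw => ?_)
        refine (enorm_sub_rpow_le_lintegral_fderiv hu hp k _ _).trans ?_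
        have h1 : (1 - s) • (x, y) + s • w - (x, y) = s • (w - (x, y)) := by module
        rw [h1]
        gcongr
        · rw [norm_smul, Real.norm_of_nonneg hs0.le]
          gcongr
          exact hd _ ⟨hx, hy⟩ _ hw
        · rename_i τ
          refine le_of_eq (congrArg g ?_)
          module
    _ = (ρ D)⁻¹ * (ENNReal.ofReal ((k + 1) * (s * d)) ^ p * ∫⁻ τ in Ioc (0 : ℝ) 1,
          ENNReal.ofReal (τ ^ k) ^ p * ∫⁻ y in B, ∫⁻ w in D,
            g ((1 - s * τ ^ (k + 1)) • (x, y) + (s * τ ^ (k + 1)) • w) ∂ρ ∂ν) := by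
        simp_rw [lintegral_const_mul' _ _ hK]
        congr 2
        have hswap (y : F) : ∫⁻ w in D, ∫⁻ τ in Ioc (0 : ℝ) 1, ENNReal.ofReal (τ ^ k) ^ p *
            g ((1 - s * τ ^ (k + 1)) • (x, y) + (s * τ ^ (k + 1)) • w) ∂volume ∂ρ =
            ∫⁻ τ in Ioc (0 : ℝ) 1, ∫⁻ w in D, ENNReal.ofReal (τ ^ k) ^ p *
            g ((1 - s * τ ^ (k + 1)) • (x, y) + (s * τ ^ (k + 1)) • w) ∂ρ :=
          lintegral_lintegral_swap (hjm.comp measurable_prodMk_left).aemeasurable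
        simp_rw [hswap]
        rw [lintegral_lintegral_swap]
        · have hτ (τ : ℝ) : ENNReal.ofReal (τ ^ k) ^ p ≠ ∞ :=
            ENNReal.rpow_ne_top_of_nonneg hp0 ENNReal.ofReal_ne_top
          simp_rw [lintegral_const_mul' _ _ (hτ _)]
        · refine Measurable.aemeasurable (Measurable.lintegral_prod_right
            (f := fun (q : F × ℝ) (w : E × F) => _) ?_)
          exact hjm.comp (by fun_prop : Measurable fun r : (F × ℝ) × (E × F) =>
            (r.1.1, r.2, r.1.2))
    _ ≤ (ρ D)⁻¹ * (ENNReal.ofReal ((k + 1) * (s * d)) ^ p * ∫⁻ τ in Ioc (0 : ℝ) 1,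
          ENNReal.ofReal ((s ^ M)⁻¹) *
            (ENNReal.ofReal (2 ^ N) * (ν B * ∫⁻ w in D, g w ∂ρ))) := by
        refine mul_le_mul' le_rfl (mul_le_mul' le_rfl
          (setLIntegral_mono' measurableSet_Ioc fun τ hτ => ?_))
        have hτ0 : 0 < τ := hτ.1
        have hpow : τ ^ (k + 1) ≤ 1 := pow_le_one₀ hτ0.le hτ.2
        have ht0 : 0 < s * τ ^ (k + 1) := by positivity
        have ht1 : s * τ ^ (k + 1) ≤ 1 / 2 := by nlinarith
        refine (mul_le_mul' le_rfl (lintegral_lintegral_comp_lineMap_le μ ν hAc hBc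
          hA.measurableSet hB.measurableSet hgm hx ht0 (by linarith))).trans ?_
        rw [← mul_assoc]
        refine mul_le_mul' ?_ (mul_le_mul' ?_ le_rfl)
        · rw [ENNReal.ofReal_rpow_of_nonneg (by positivity) hp0,
            ← ENNReal.ofReal_mul (by positivity)]
          apply ENNReal.ofReal_le_ofReal
          have h1 : (τ ^ k) ^ p ≤ (τ ^ (k + 1)) ^ M := by
            rw [← pow_mul, ← Real.rpow_natCast, ← Real.rpow_natCast, ← Real.rpow_mul hτ0.le]
            apply Real.rpow_le_rpow_of_exponent_ge hτ0 hτ.2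
            push_cast
            exact hk
          rw [mul_pow, mul_inv, mul_left_comm]
          refine mul_le_of_le_one_right (by positivity) ?_
          rw [← div_eq_mul_inv]
          exact div_le_one_of_le₀ h1 (by positivity)
        · apply ENNReal.ofReal_le_ofReal
          rw [← inv_pow]
          refine pow_le_pow_left₀ (inv_nonneg.2 (by linarith)) ?_ _
          rw [inv_le_comm₀ (by linarith) (by norm_num)]
          linarith
    _ = _ := by
        have h1 : ENNReal.ofReal ((k + 1) * (s * d)) ^ p =
            ENNReal.ofReal ((k + 1) * d) ^ p * ENNReal.ofReal (s ^ p) := by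
          rw [mul_left_comm, mul_comm s, ENNReal.ofReal_mul (by positivity),
            ENNReal.mul_rpow_of_nonneg _ _ hp0, ENNReal.ofReal_rpow_of_nonneg hs0.le hp0]
        have h2 : ENNReal.ofReal (s ^ (p - M)) =
            ENNReal.ofReal (s ^ p) * ENNReal.ofReal ((s ^ M)⁻¹) := by
          rw [← ENNReal.ofReal_mul (by positivity), Real.rpow_sub hs0, Real.rpow_natCast,
            div_eq_mul_inv]
        rw [h1, h2, setLIntegral_const]
        simp only [Real.volume_Ioc, sub_zero, ENNReal.ofReal_one, mul_one]
        ring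
end

/-- A bounded equi-Lipschitz family on a compact set is uniformly Cauchy along every ultrafilter. -/
theorem exists_mem_ultrafilter_dist_lt_of_lipschitzOnWith {X ι : Type*} [PseudoMetricSpace X]
    {D : Set X} (hD : IsCompact D) (𝒰 : Ultrafilter ι) {f : ι → X → ℝ} {M : ℝ} {L : NNReal}
    (hM : ∀ i, ∀ z ∈ D, |f i z| ≤ M) (hL : ∀ i, LipschitzOnWith L (f i) D) {ε : ℝ} (hε : 0 < ε) :
    ∃ S ∈ 𝒰, ∀ i ∈ S, ∀ j ∈ S, ∀ z ∈ D, dist (f i z) (f j z) < ε := by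
  have : CompactSpace D := isCompact_iff_compactSpace.1 hD
  let Φ : ι → BoundedContinuousFunction D ℝ := fun i =>
    BoundedContinuousFunction.mkOfCompact ⟨D.domRestrict (f i), (hL i).continuousOn.domRestrict⟩
  have hΦ (i : ι) (z : D) : Φ i z = f i z := rfl
  have hcomp : IsCompact (closure (range Φ)) := by
    refine BoundedContinuousFunction.arzela_ascoli (Icc (-M) M) isCompact_Icc _ ?_ ?_
    · rintro _ z ⟨i, rfl⟩
      exact abs_le.1 (hM i z z.2)
    · refine (LipschitzWith.uniformEquicontinuous _ L ?_).equicontinuous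
      rintro ⟨_, i, rfl⟩
      exact (hL i).to_restrict
  obtain ⟨g, -, hg⟩ := hcomp.ultrafilter_le_nhds (𝒰.map Φ) (by
    rw [le_principal_iff]
    exact mem_of_superset (image_mem_map univ_mem)
      ((image_subset_range _ _).trans subset_closure))
  refine ⟨Φ ⁻¹' ball g (ε / 2), hg (ball_mem_nhds g (half_pos hε)), fun i hi j hj z hz => ?_⟩
  have h1 := (Φ i).dist_coe_le_dist (g := Φ j) ⟨z, hz⟩
  have h2 := dist_triangle_right (Φ i) (Φ j) g
  rw [mem_preimage, mem_ball] at hi hj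
  rw [hΦ, hΦ] at h1
  dsimp only at h1
  linarith

/-- Diagonal extraction of a Cauchy subsequence from Cauchyness along an ultrafilter. -/
theorem exists_strictMono_of_forall_mem_ultrafilter {Q : ℝ → ℕ → ℕ → Prop} {𝒰 : Ultrafilter ℕ}
    (h𝒰 : (𝒰 : Filter ℕ) ≤ atTop) (hmono : ∀ ε ε' i j, ε ≤ ε' → Q ε i j → Q ε' i j)
    (hQ : ∀ ε > 0, ∃ S ∈ 𝒰, ∀ i ∈ S, ∀ j ∈ S, Q ε i j) :
    ∃ φ : ℕ → ℕ, StrictMono φ ∧ ∀ ε > 0, ∃ K, ∀ i j, K ≤ i → K ≤ j → Q ε (φ i) (φ j) := by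
  choose S hS hSQ using fun n : ℕ => hQ (1 / (n + 1)) Nat.one_div_pos_of_nat
  obtain ⟨φ, hφ, hφS⟩ := extraction_forall_of_frequently
    (P := fun n k => ∀ l ∈ Iic n, k ∈ S l) fun n => by
      have h : ∀ᶠ k in (𝒰 : Filter ℕ), ∀ l ∈ Iic n, k ∈ S l :=
        (eventually_all_finite (finite_Iic n)).2 fun l _ => hS l
      exact h.frequently.filter_mono h𝒰
  refine ⟨φ, hφ, fun ε hε => ?_⟩
  obtain ⟨K, hK⟩ := exists_nat_one_div_lt hε
  exact ⟨K, fun i j hi hj => hmono _ _ _ _ hK.le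
    (hSQ K _ (hφS i K hi) _ (hφS j K hj))⟩

theorem setLIntegral_enorm_rpow_add_eq_ofReal {G : Type*} [NormedAddCommGroup G] [NormedSpace ℝ G]
    [MeasurableSpace G] [BorelSpace G] {ρ : Measure G} [IsFiniteMeasureOnCompacts ρ] {D : Set G}
    (hD : IsCompact D) {p : ℝ} (hp : 0 ≤ p) {u : G → ℝ} (hu : ContDiff ℝ 1 u) :
    ∫⁻ z in D, (‖u z‖ₑ ^ p + ‖fderiv ℝ u z‖ₑ ^ p) ∂ρ =
      ENNReal.ofReal (∫ z in D, (|u z| ^ p + ‖fderiv ℝ u z‖ ^ p) ∂ρ) := by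
  have hc : Continuous fun z => |u z| ^ p + ‖fderiv ℝ u z‖ ^ p :=
    (hu.continuous.abs.rpow_const fun _ => Or.inr hp).add
      ((hu.continuous_fderiv one_ne_zero).norm.rpow_const fun _ => Or.inr hp)
  rw [ofReal_integral_eq_lintegral_ofReal (hc.continuousOn.integrableOn_compact hD)
    (ae_of_all _ fun z => by positivity)]
  refine lintegral_congr fun z => ?_
  rw [ENNReal.ofReal_add (by positivity) (by positivity), ← Real.norm_eq_abs,
    ← ENNReal.ofReal_rpow_of_nonneg (norm_nonneg _) hp,
    ← ENNReal.ofReal_rpow_of_nonneg (norm_nonneg _) hp, ofReal_norm, ofReal_norm]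

theorem dilatedAverage_const_ne_top {G : Type*} [MeasurableSpace G] {ρ : Measure G} {D : Set G}
    (hρ : ρ D ≠ 0) {r p : ℝ} (hp : 0 ≤ p) {R : ℝ≥0∞} (hR : R ≠ ∞) : ((ρ D)⁻¹ * (ENNReal.ofReal r * R)) ^ p⁻¹ ≠ ∞ :=
  ENNReal.rpow_ne_top_of_nonneg (by positivity)
    (ENNReal.mul_ne_top (by simpa using hρ) (ENNReal.mul_ne_top ENNReal.ofReal_ne_top hR))

section
variable {G : Type*} [NormedAddCommGroup G] [NormedSpace ℝ G] [FiniteDimensional ℝ G]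
  [MeasurableSpace G] [BorelSpace G] {ρ : Measure G} [ρ.IsAddHaarMeasure] {D : Set G}

theorem lipschitzOnWith_dilatedAverage (hD : IsCompact D) (hDc : Convex ℝ D) (hρ : ρ D ≠ 0)
    {s : ℝ} (hs0 : 0 < s) (hs1 : s < 1) {p : ℝ} (hp : 1 ≤ p) {u : G → ℝ} (hu : ContDiff ℝ 1 u)
    {R : ℝ≥0∞} (hR : R ≠ ∞) (hu1 : ∫⁻ z in D, ‖fderiv ℝ u z‖ₑ ^ p ∂ρ ≤ R) :
    LipschitzOnWith (((ρ D)⁻¹ *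
        (ENNReal.ofReal ((s ^ Module.finrank ℝ G)⁻¹) * R)) ^ p⁻¹).toNNReal
      (dilatedAverage ρ D s u) D := by
  intro z' hz' z hz
  have hp0 : 0 < p := by linarith
  have h := (enorm_dilatedAverage_sub_rpow_le hD hDc hρ hs0 hs1 hp hu hz hz').trans
    (mul_le_mul' le_rfl (mul_le_mul' le_rfl (mul_le_mul' le_rfl hu1)))
  rw [← ENNReal.le_rpow_inv_iff hp0, ENNReal.mul_rpow_of_nonneg _ _ (by positivity),
    ENNReal.rpow_rpow_inv hp0.ne', ofReal_norm] at h
  rwa [edist_eq_enorm_sub, edist_eq_enorm_sub,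
    ENNReal.coe_toNNReal (dilatedAverage_const_ne_top hρ hp0.le hR), mul_comm]

/-- The dilated averages of a `W^{1,p}`-bounded family are uniformly Cauchy along every
ultrafilter. -/
theorem exists_mem_ultrafilter_dist_dilatedAverage_lt {ι : Type*} (hD : IsCompact D)
    (hDc : Convex ℝ D) (hρ : ρ D ≠ 0) {s : ℝ} (hs0 : 0 < s) (hs1 : s < 1) {p : ℝ} (hp : 1 ≤ p)
    {u : ι → G → ℝ} (hu : ∀ i, ContDiff ℝ 1 (u i)) {R : ℝ≥0∞} (hR : R ≠ ∞)
    (hu0 : ∀ i, ∫⁻ z in D, ‖u i z‖ₑ ^ p ∂ρ ≤ R)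
    (hu1 : ∀ i, ∫⁻ z in D, ‖fderiv ℝ (u i) z‖ₑ ^ p ∂ρ ≤ R)
    (𝒰 : Ultrafilter ι) {δ : ℝ} (hδ : 0 < δ) :
    ∃ S ∈ 𝒰, ∀ i ∈ S, ∀ j ∈ S, ∀ z ∈ D,
      dist (dilatedAverage ρ D s (u i) z) (dilatedAverage ρ D s (u j) z) < δ := by
  have hp0 : 0 < p := by linarith
  refine exists_mem_ultrafilter_dist_lt_of_lipschitzOnWith hD 𝒰 (M := (((ρ D)⁻¹ *
        (ENNReal.ofReal ((s ^ Module.finrank ℝ G)⁻¹) * R)) ^ p⁻¹).toReal) (fun i z hz => ?_)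
    (fun i => lipschitzOnWith_dilatedAverage hD hDc hρ hs0 hs1 hp (hu i) hR (hu1 i)) hδ
  have h := (enorm_dilatedAverage_rpow_le hD hDc hρ hs0 hs1 hp (hu i).continuous hz).trans
    (mul_le_mul' le_rfl (mul_le_mul' le_rfl (hu0 i)))
  rw [← ENNReal.le_rpow_inv_iff hp0] at h
  simpa using ENNReal.toReal_mono (dilatedAverage_const_ne_top hρ hp0.le hR) h

end

theorem enorm_add_add_rpow_le {a b c : ℝ} {p : ℝ} (hp : 0 ≤ p) :
    ‖a + b + c‖ₑ ^ p ≤ 3 ^ p * (‖a‖ₑ ^ p + ‖b‖ₑ ^ p + ‖c‖ₑ ^ p) := by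
  have hle : ‖a + b + c‖ₑ ≤ 3 * max (max ‖a‖ₑ ‖b‖ₑ) ‖c‖ₑ := by
    refine (enorm_add_le _ _).trans ((add_le_add_left (enorm_add_le _ _) _).trans ?_)
    have : (3 : ℝ≥0∞) = 1 + 1 + 1 := by norm_num
    rw [this, add_mul, add_mul, one_mul]
    gcongr <;> simp
  calc ‖a + b + c‖ₑ ^ p ≤ (3 * max (max ‖a‖ₑ ‖b‖ₑ) ‖c‖ₑ) ^ p := by gcongr
    _ = 3 ^ p * max (max (‖a‖ₑ ^ p) (‖b‖ₑ ^ p)) (‖c‖ₑ ^ p) := by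
        rw [ENNReal.mul_rpow_of_nonneg _ _ hp, (ENNReal.monotone_rpow_of_nonneg hp).map_max,
          (ENNReal.monotone_rpow_of_nonneg hp).map_max]
    _ ≤ _ := by
        gcongr
        exact (max_le_add_of_nonneg zero_le zero_le).trans
          (add_le_add_left (max_le_add_of_nonneg zero_le zero_le) _)

/-- On the slices `{x} × B`, `x ∈ A`, a `W^{1,p}`-bounded family of `C¹` functions on `A × B` is
`L^p`-Cauchy along every ultrafilter, uniformly in `x`, as soon as `p > dim E`. -/
theorem exists_mem_ultrafilter_lintegral_sub_rpow_le {E F ι : Type*} [NormedAddCommGroup E]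
    [NormedSpace ℝ E] [FiniteDimensional ℝ E] [MeasurableSpace E] [BorelSpace E]
    [NormedAddCommGroup F] [NormedSpace ℝ F] [FiniteDimensional ℝ F] [MeasurableSpace F]
    [BorelSpace F] {μ : Measure E} [μ.IsAddHaarMeasure] {ν : Measure F} [ν.IsAddHaarMeasure]
    {A : Set E} {B : Set F} (hA : IsCompact A) (hB : IsCompact B) (hAc : Convex ℝ A)
    (hBc : Convex ℝ B) (hρ : (μ.prod ν) (A ×ˢ B) ≠ 0) {p : ℝ} (hp : 1 ≤ p)
    (hpE : Module.finrank ℝ E < p) {u : ι → E × F → ℝ} (hu : ∀ i, ContDiff ℝ 1 (u i))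
    {R : ℝ≥0∞} (hR : R ≠ ∞) (hu0 : ∀ i, ∫⁻ z in A ×ˢ B, ‖u i z‖ₑ ^ p ∂(μ.prod ν) ≤ R)
    (hu1 : ∀ i, ∫⁻ z in A ×ˢ B, ‖fderiv ℝ (u i) z‖ₑ ^ p ∂(μ.prod ν) ≤ R)
    (𝒰 : Ultrafilter ι) {ε : ℝ≥0∞} (hε : 0 < ε) :
    ∃ S ∈ 𝒰, ∀ i ∈ S, ∀ j ∈ S, ∀ x ∈ A,
      ∫⁻ y in B, ‖u i (x, y) - u j (x, y)‖ₑ ^ p ∂ν ≤ ε := by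
  have hp0 : 0 < p := by linarith
  set D := A ×ˢ B with hDdef
  set ρ := μ.prod ν with hρdef
  set m := Module.finrank ℝ E with hm
  have hD : IsCompact D := hA.prod hB
  have hDc : Convex ℝ D := hAc.prod hBc
  have hd : ∀ z ∈ D, ∀ w ∈ D, ‖w - z‖ ≤ diam D := fun z hz w hw => by
    rw [← dist_eq_norm]
    exact dist_le_diam_of_mem hD.isBounded hw hz
  obtain ⟨k, hk⟩ := exists_nat_ge (m / (p - m))
  have hk' : ((k + 1) * m : ℝ) ≤ k * p := by
    rw [div_le_iff₀ (by linarith)] at hk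
    linarith
  set C : ℝ≥0∞ := (ρ D)⁻¹ * (ENNReal.ofReal ((k + 1) * diam D) ^ p *
    (ENNReal.ofReal (2 ^ Module.finrank ℝ F) * (ν B * R))) with hC
  have hC_top : C ≠ ∞ := ENNReal.mul_ne_top (by simpa using hρ) (ENNReal.mul_ne_top
    (ENNReal.rpow_ne_top_of_nonneg hp0.le ENNReal.ofReal_ne_top) (ENNReal.mul_ne_top
    ENNReal.ofReal_ne_top (ENNReal.mul_ne_top hB.measure_ne_top hR)))
  have htendsto : Tendsto (fun s : ℝ => (3 : ℝ≥0∞) ^ p * (ENNReal.ofReal (s ^ (p - m)) * C +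
      ENNReal.ofReal (s ^ p) * ν B + ENNReal.ofReal (s ^ (p - m)) * C)) (𝓝[>] 0) (𝓝 0) := by
    have hpow {r : ℝ} (hr : 0 < r) :
        Tendsto (fun s : ℝ => ENNReal.ofReal (s ^ r)) (𝓝[>] 0) (𝓝 0) :=
      ((ENNReal.continuous_ofReal.comp (Real.continuous_rpow_const hr.le)).tendsto' 0 0
        (by simp [hr.ne'])).mono_left nhdsWithin_le_nhds
    have h1 := ENNReal.Tendsto.mul_const (hpow (sub_pos.2 hpE)) (Or.inr hC_top)
    have h2 := ENNReal.Tendsto.mul_const (hpow hp0) (Or.inr (hB.measure_ne_top (μ := ν)))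
    have h3 := ENNReal.Tendsto.const_mul ((h1.add h2).add h1)
      (Or.inr (ENNReal.rpow_ne_top_of_nonneg hp0.le (by norm_num : (3 : ℝ≥0∞) ≠ ∞)))
    simpa using h3
  obtain ⟨s, hs, hs0, hs1⟩ := ((htendsto.eventually_le_const hε).and
    (Ioc_mem_nhdsGT (by norm_num : (0 : ℝ) < 1 / 2))).exists
  have hs1' : s < 1 := by linarith
  obtain ⟨S, hS, hST⟩ := exists_mem_ultrafilter_dist_dilatedAverage_lt hD hDc hρ hs0 hs1'
    hp hu hR hu0 hu1 𝒰 hs0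
  set T : ι → E × F → ℝ := fun i => dilatedAverage ρ D s (u i) with hT
  refine ⟨S, hS, fun i hi j hj x hx => le_trans ?_ hs⟩
  have hclose (i : ι) : ∫⁻ y in B, ‖T i (x, y) - u i (x, y)‖ₑ ^ p ∂ν ≤
      ENNReal.ofReal (s ^ (p - m)) * C := by
    refine (lintegral_sub_dilatedAverage_rpow_le hA hB hAc hBc hρ hd hp hk' (hu i) hs0 hs1
      hx).trans ?_
    rw [hC]
    gcongr
    exact hu1 i
  have hTc (i : ι) : AEMeasurable (fun y => ‖T i (x, y) - u i (x, y)‖ₑ ^ p) (ν.restrict B) := by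
    have hTi : ContinuousOn (fun y => T i (x, y)) B :=
      (lipschitzOnWith_dilatedAverage hD hDc hρ hs0 hs1' hp (hu i) hR (hu1 i)).continuousOn.comp
        (by fun_prop) fun y hy => ⟨hx, hy⟩
    have hui := (hu i).continuous
    exact ((hTi.sub (by fun_prop : Continuous fun y => u i (x, y)).continuousOn).aemeasurable
      hB.measurableSet).enorm.pow_const p
  calc ∫⁻ y in B, ‖u i (x, y) - u j (x, y)‖ₑ ^ p ∂ν
      ≤ ∫⁻ y in B, 3 ^ p * (‖T i (x, y) - u i (x, y)‖ₑ ^ p + ENNReal.ofReal (s ^ p) +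
          ‖T j (x, y) - u j (x, y)‖ₑ ^ p) ∂ν := by
        refine setLIntegral_mono' hB.measurableSet fun y hy => ?_
        have hsplit : u i (x, y) - u j (x, y) = -(T i (x, y) - u i (x, y)) +
            (T i (x, y) - T j (x, y)) + (T j (x, y) - u j (x, y)) := by ring
        rw [hsplit]
        refine (enorm_add_add_rpow_le hp0.le).trans ?_
        rw [enorm_neg]
        gcongr
        rw [← ENNReal.ofReal_rpow_of_nonneg hs0.le hp0.le]
        gcongr
        rw [← ofReal_norm, ← dist_eq_norm]
        exact ENNReal.ofReal_le_ofReal (hST i hi j hj _ ⟨hx, hy⟩).le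
    _ ≤ _ := by
        rw [lintegral_const_mul' _ _ (ENNReal.rpow_ne_top_of_nonneg hp0.le (by norm_num)),
          lintegral_add_right' _ (hTc j), lintegral_add_left' (hTc i), setLIntegral_const]
        gcongr
        · exact hclose i
        · exact hclose j

/-- Euclidean chart case of the compact embedding
`W^{1,p}(M × N) ↪ L^∞(M, L^p(N))`: if `p > m` and `p > n` and `(u_k)` is a
sequence of `C¹` functions on `ℝ^m × ℝ^n` with a uniform `W^{1,p}`-bound `R`
over `B₂ × N` (where `B₂ ⊂ ℝ^m` is the closed ball of radius 2 and `N ⊂ ℝ^n`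
the closed unit ball), then some subsequence is uniformly Cauchy in `L^p(N)`
over the closed unit ball `B₁ ⊂ ℝ^m`. -/
theorem stmt_0 (m n : ℕ) (hm : 1 ≤ m) (hn : 1 ≤ n) (p : ℝ)
    (hpm : (m : ℝ) < p) (hpn : (n : ℝ) < p)
    (u : ℕ → EuclideanSpace ℝ (Fin m) × EuclideanSpace ℝ (Fin n) → ℝ)
    (hu : ∀ k, ContDiff ℝ 1 (u k)) (R : ℝ) (hR : 0 ≤ R)
    (hbound : ∀ k,
      (∫ z in (closedBall (0 : EuclideanSpace ℝ (Fin m)) 2) ×ˢ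
          (closedBall (0 : EuclideanSpace ℝ (Fin n)) 1),
        |u k z| ^ p + ‖fderiv ℝ (u k) z‖ ^ p) ≤ R) :
    ∃ φ : ℕ → ℕ, StrictMono φ ∧
      ∀ ε > (0 : ℝ), ∃ K : ℕ, ∀ i j : ℕ, K ≤ i → K ≤ j →
        ∀ x ∈ closedBall (0 : EuclideanSpace ℝ (Fin m)) 1,
          (∫ y in closedBall (0 : EuclideanSpace ℝ (Fin n)) 1,
            |u (φ i) (x, y) - u (φ j) (x, y)| ^ p) ≤ ε := by
  have hm1 : (1 : ℝ) ≤ m := by exact_mod_cast hm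
  have hp : 1 ≤ p := by linarith
  have hp0 : 0 ≤ p := by linarith
  have hA := isCompact_closedBall (0 : EuclideanSpace ℝ (Fin m)) 2
  have hB := isCompact_closedBall (0 : EuclideanSpace ℝ (Fin n)) 1
  have huR (k : ℕ) := (setLIntegral_enorm_rpow_add_eq_ofReal (ρ := volume) (hA.prod hB) hp0
    (hu k)).trans_le (ENNReal.ofReal_le_ofReal (hbound k))
  have hρ : ((volume : Measure (EuclideanSpace ℝ (Fin m))).prod
      (volume : Measure (EuclideanSpace ℝ (Fin n)))) (closedBall 0 2 ×ˢ closedBall 0 1) ≠ 0 := by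
    rw [Measure.prod_prod]
    exact mul_ne_zero (measure_closedBall_pos _ _ two_pos).ne'
      (measure_closedBall_pos _ _ one_pos).ne'
  refine exists_strictMono_of_forall_mem_ultrafilter Nat.hyperfilter_le_atTop
    (Q := fun ε i j => ∀ x ∈ closedBall (0 : EuclideanSpace ℝ (Fin m)) 1,
      (∫ y in closedBall (0 : EuclideanSpace ℝ (Fin n)) 1, |u i (x, y) - u j (x, y)| ^ p) ≤ ε)
    (fun ε ε' i j hε h x hx => (h x hx).trans hε) fun ε hε => ?_
  obtain ⟨S, hS, hSu⟩ := exists_mem_ultrafilter_lintegral_sub_rpow_le hA hB (convex_closedBall _ _)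
    (convex_closedBall _ _) hρ hp (by rwa [finrank_euclideanSpace_fin]) hu ENNReal.ofReal_ne_top
    (fun k => (lintegral_mono fun z => le_self_add).trans (huR k))
    (fun k => (lintegral_mono fun z => le_add_self).trans (huR k)) (hyperfilter ℕ)
    (ENNReal.ofReal_pos.2 hε)
  refine ⟨S, hS, fun i hi j hj x hx => ?_⟩
  have hui := (hu i).continuous
  have huj := (hu j).continuous
  have hcont : Continuous fun y => |u i (x, y) - u j (x, y)| ^ p :=
    (by fun_prop : Continuous fun y => |u i (x, y) - u j (x, y)|).rpow_const fun _ => Or.inr hp0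
  rw [← ENNReal.ofReal_le_ofReal_iff hε.le, ofReal_integral_eq_lintegral_ofReal
    (hcont.continuousOn.integrableOn_compact hB) (ae_of_all _ fun y => by positivity)]
  refine (lintegral_congr fun y => ?_).trans_le
    (hSu i hi j hj x (closedBall_subset_closedBall one_le_two hx))
  rw [← Real.norm_eq_abs, ← ENNReal.ofReal_rpow_of_nonneg (norm_nonneg _) hp0, ofReal_norm]
end

section
/- Let m, n ≥ 1 be integers and let p > m be real. Then there is a constant C, depending only on m, n, p, such that every continuously differentiable function u : ℝ^m × ℝ^n → ℝ satisfies, for all x, y in B₂, the Hölder-type equicontinuity estimate ∫_N |u(x,z) − u(y,z)|^p dz ≤ C · |x − y|^{p−m} · ∫_{B₂ × N} (|u|^p + ‖Du‖^p); equivalently, the map x ↦ u(x,·) is Hölder continuous with exponent λ = 1 − m/p from B₂ into L^p(N), with Hölder constant controlled by the W^{1,p}-norm of u on B₂ × N. -/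
open MeasureTheory Metric
open Set
open scoped ENNReal

lemma lintegral_Ioc_rpow_ne_top {s : ℝ} (hs : -1 < s) :
    ∫⁻ t in Ioc (0 : ℝ) 1, ENNReal.ofReal (t ^ s) ≠ ⊤ := by
  have h := (intervalIntegral.intervalIntegrable_rpow' (a := 0) (b := 1) hs)
  rw [intervalIntegrable_iff_integrableOn_Ioc_of_le zero_le_one] at h
  exact h.lintegral_lt_top.ne

/-- Weighted Hölder form of the fundamental theorem of calculus on `[0, 1]`. -/
lemma exists_enorm_sub_rpow_le_lintegral_weight {p b : ℝ} (hp : 1 < p) (hb : b < p - 1) :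
    ∃ K : ℝ≥0∞, K ≠ ⊤ ∧ ∀ h h' : ℝ → ℝ, (∀ t, HasDerivAt h (h' t) t) → Continuous h' →
      ‖h 1 - h 0‖ₑ ^ p ≤ K * ∫⁻ t in Ioc (0 : ℝ) 1, ENNReal.ofReal (t ^ b) * ‖h' t‖ₑ ^ p := by
  have hp0 : 0 < p := by linarith
  have hpq := Real.HolderConjugate.conjExponent hp
  set q := p.conjExponent with hq
  have hq0 : 0 < q := hpq.symm.pos
  refine ⟨(∫⁻ t in Ioc (0 : ℝ) 1, ENNReal.ofReal (t ^ (-b / p * q))) ^ (1 / q * p), ?_, ?_⟩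
  · refine ENNReal.rpow_ne_top_of_nonneg (by positivity) (lintegral_Ioc_rpow_ne_top ?_)
    have : -b / p * q = -b / (p - 1) := by
      rw [hq, Real.conjExponent]; field_simp
    rw [this, lt_div_iff₀ (by linarith)]
    linarith
  intro h h' hd hc
  have hftc : h 1 - h 0 = ∫ t in Ioc (0 : ℝ) 1, h' t := by
    rw [← intervalIntegral.integral_of_le zero_le_one]
    exact (intervalIntegral.integral_eq_sub_of_hasDerivAt (fun t _ => hd t)
      (hc.intervalIntegrable _ _)).symm
  have hle : ‖h 1 - h 0‖ₑ ≤ ∫⁻ t in Ioc (0 : ℝ) 1,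
      ((fun t => ENNReal.ofReal (t ^ (-b / p))) *
        (fun t => ENNReal.ofReal (t ^ (b / p)) * ‖h' t‖ₑ)) t := by
    rw [hftc]
    refine (enorm_integral_le_lintegral_enorm _).trans_eq
      (setLIntegral_congr_fun measurableSet_Ioc fun t ht => ?_)
    have : t ^ (-b / p) * t ^ (b / p) = 1 := by
      rw [← Real.rpow_add ht.1, neg_div, neg_add_cancel, Real.rpow_zero]
    simp only [Pi.mul_apply]
    rw [← mul_assoc, ← ENNReal.ofReal_mul (Real.rpow_nonneg ht.1.le _), this]
    simp
  have hholder := ENNReal.lintegral_mul_le_Lp_mul_Lq (volume.restrict (Ioc (0 : ℝ) 1)) hpq.symm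
    (f := fun t => ENNReal.ofReal (t ^ (-b / p)))
    (g := fun t => ENNReal.ofReal (t ^ (b / p)) * ‖h' t‖ₑ)
    (by fun_prop) (by fun_prop)
  refine (ENNReal.rpow_le_rpow (hle.trans hholder) hp0.le).trans_eq ?_
  rw [ENNReal.mul_rpow_of_nonneg _ _ hp0.le, ← ENNReal.rpow_mul, ← ENNReal.rpow_mul,
    one_div_mul_cancel hp0.ne', ENNReal.rpow_one]
  congr 1
  · congr 1
    refine setLIntegral_congr_fun measurableSet_Ioc fun t ht => ?_
    rw [ENNReal.ofReal_rpow_of_nonneg (Real.rpow_nonneg ht.1.le _) hq0.le, ← Real.rpow_mul ht.1.le]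
  · refine setLIntegral_congr_fun measurableSet_Ioc fun t ht => ?_
    rw [ENNReal.mul_rpow_of_nonneg _ _ hp0.le,
      ENNReal.ofReal_rpow_of_nonneg (Real.rpow_nonneg ht.1.le _) hp0.le, ← Real.rpow_mul ht.1.le,
      div_mul_cancel₀ _ hp0.ne']

/-- A ball of radius `‖x - y‖ / 4` inside `B₂`, within distance `‖x - y‖` of both `x` and `y`. -/
lemma exists_closedBall_subset_closedBall_two {E : Type*} [NormedAddCommGroup E]
    [NormedSpace ℝ E] {x y : E} (hx : x ∈ closedBall (0 : E) 2) (hy : y ∈ closedBall (0 : E) 2) :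
    ∃ c : E, closedBall c (‖x - y‖ / 4) ⊆ closedBall 0 2 ∧
      ∀ w ∈ closedBall c (‖x - y‖ / 4), ‖w - x‖ ≤ ‖x - y‖ ∧ ‖w - y‖ ≤ ‖x - y‖ := by
  rw [mem_closedBall_zero_iff] at hx hy
  set r := ‖x - y‖ with hr
  have hr4 : r ≤ 4 := (norm_sub_le x y).trans (by linarith)
  have hr0 : 0 ≤ r := norm_nonneg _
  set q : E := (1 / 2 : ℝ) • (x + y) with hq
  have hq2 : ‖q‖ ≤ 2 := by
    rw [hq, norm_smul, Real.norm_of_nonneg (by norm_num)]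
    linarith [norm_add_le x y]
  have hqx : ‖q - x‖ = r / 2 := by
    have : q - x = (-(1 / 2) : ℝ) • (x - y) := by rw [hq]; module
    rw [this, norm_smul, ← hr]; norm_num; ring
  have hqy : ‖q - y‖ = r / 2 := by
    have : q - y = (1 / 2 : ℝ) • (x - y) := by rw [hq]; module
    rw [this, norm_smul, ← hr]; norm_num; ring
  set c : E := (1 - r / 8) • q with hc
  have hcn : ‖c‖ ≤ 2 - r / 4 := by
    rw [hc, norm_smul, Real.norm_of_nonneg (by linarith)]
    nlinarith
  have hcq : ‖c - q‖ ≤ r / 4 := by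
    have : c - q = (-(r / 8)) • q := by rw [hc]; module
    rw [this, norm_smul, norm_neg, Real.norm_of_nonneg (by linarith)]
    nlinarith
  refine ⟨c, fun w hw => ?_, fun w hw => ?_⟩
  · rw [mem_closedBall_iff_norm] at hw
    rw [mem_closedBall_zero_iff]
    linarith [norm_sub_norm_le w c]
  · rw [mem_closedBall_iff_norm] at hw
    constructor
    · linarith [norm_sub_le_norm_sub_add_norm_sub w c x, norm_sub_le_norm_sub_add_norm_sub c q x]
    · linarith [norm_sub_le_norm_sub_add_norm_sub w c y, norm_sub_le_norm_sub_add_norm_sub c q y]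

section Morrey

variable {E : Type*} [NormedAddCommGroup E] [NormedSpace ℝ E] [FiniteDimensional ℝ E]
  [MeasurableSpace E] [BorelSpace E] (μ : Measure E) [μ.IsAddHaarMeasure]

lemma lintegral_comp_add_smul_sub {F : E → ℝ≥0∞} (hF : Measurable F) (x : E) {t : ℝ}
    (ht : 0 < t) :
    ∫⁻ w, F (x + t • (w - x)) ∂μ =
      ENNReal.ofReal ((t ^ Module.finrank ℝ E)⁻¹) * ∫⁻ w, F w ∂μ := by
  rw [lintegral_sub_right_eq_self (fun w => F (x + t • w)) x,
    ← lintegral_map (f := fun w => F (x + w)) (by fun_prop) (measurable_const_smul t),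
    Measure.map_addHaar_smul μ ht.ne', lintegral_smul_measure,
    lintegral_add_left_eq_self (fun w => F w) x, abs_of_nonneg (by positivity), smul_eq_mul]

/-- If every point of `W` lies in a convex set `B ∋ x` at distance at most `r` from `x`, then the
`p`-th power mean oscillation of `f` over `W` about `f x` is controlled by the gradient on `B`. -/
lemma exists_setLIntegral_enorm_sub_rpow_le {p : ℝ} (hp : 1 < p)
    (hd : (Module.finrank ℝ E : ℝ) < p) :
    ∃ K : ℝ≥0∞, K ≠ ⊤ ∧ ∀ f : E → ℝ, ContDiff ℝ 1 f → ∀ B W : Set E, Convex ℝ B →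
      MeasurableSet B → MeasurableSet W → W ⊆ B → ∀ x ∈ B, ∀ r : ℝ,
      (∀ w ∈ W, ‖w - x‖ ≤ r) →
      ∫⁻ w in W, ‖f w - f x‖ₑ ^ p ∂μ ≤
        K * ENNReal.ofReal r ^ p * ∫⁻ w in B, ‖fderiv ℝ f w‖ₑ ^ p ∂μ := by
  set d := Module.finrank ℝ E with hd_def
  have hp0 : 0 < p := by linarith
  obtain ⟨b, hb₁, hb₂⟩ : ∃ b : ℝ, d - 1 < b ∧ b < p - 1 := exists_between (by linarith)
  obtain ⟨K, hK, hKle⟩ := exists_enorm_sub_rpow_le_lintegral_weight hp hb₂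
  refine ⟨K * ∫⁻ t in Ioc (0 : ℝ) 1, ENNReal.ofReal (t ^ (b - d)),
    ENNReal.mul_ne_top hK (lintegral_Ioc_rpow_ne_top (by linarith)), ?_⟩
  intro f hf B W hBc hBm hWm hWB x hx r hr
  have hdf : Continuous (fderiv ℝ f) := hf.continuous_fderiv one_ne_zero
  have hpoint : ∀ w ∈ W, ‖f w - f x‖ₑ ^ p ≤ K * ENNReal.ofReal r ^ p *
      ∫⁻ t in Ioc (0 : ℝ) 1, ENNReal.ofReal (t ^ b) * ‖fderiv ℝ f (x + t • (w - x))‖ₑ ^ p := by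
    intro w hw
    have key := hKle (fun t => f (x + t • (w - x))) (fun t => fderiv ℝ f (x + t • (w - x)) (w - x))
      (fun t => by
        have h1 : HasDerivAt (fun t : ℝ => x + t • (w - x)) (w - x) t := by
          simpa using ((hasDerivAt_id t).smul_const (w - x)).const_add x
        exact ((hf.differentiable one_ne_zero _).hasFDerivAt).comp_hasDerivAt t h1)
      (by fun_prop)
    simp only [one_smul, zero_smul, add_zero, add_sub_cancel] at key
    refine key.trans ?_
    rw [mul_assoc]
    gcongr K * ?_
    rw [← lintegral_const_mul _ (by fun_prop)]
    refine lintegral_mono fun t => ?_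
    have h2 : ‖fderiv ℝ f (x + t • (w - x)) (w - x)‖ₑ ≤
        ‖fderiv ℝ f (x + t • (w - x))‖ₑ * ENNReal.ofReal r := by
      refine (ContinuousLinearMap.le_opENorm _ _).trans ?_
      gcongr
      rw [← ofReal_norm]
      exact ENNReal.ofReal_le_ofReal (hr w hw)
    calc ENNReal.ofReal (t ^ b) * ‖fderiv ℝ f (x + t • (w - x)) (w - x)‖ₑ ^ p
        ≤ ENNReal.ofReal (t ^ b) *
          (‖fderiv ℝ f (x + t • (w - x))‖ₑ * ENNReal.ofReal r) ^ p := by gcongr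
      _ = _ := by rw [ENNReal.mul_rpow_of_nonneg _ _ hp0.le]; ring
  have hscale : ∀ t ∈ Ioc (0 : ℝ) 1,
      ∫⁻ w in W, ENNReal.ofReal (t ^ b) * ‖fderiv ℝ f (x + t • (w - x))‖ₑ ^ p ∂μ ≤
        ENNReal.ofReal (t ^ (b - d)) * ∫⁻ w in B, ‖fderiv ℝ f w‖ₑ ^ p ∂μ := by
    intro t ht
    have hFm : Measurable (B.indicator fun w => ‖fderiv ℝ f w‖ₑ ^ p) :=
      Measurable.indicator (by fun_prop) hBm
    rw [lintegral_const_mul _ (by fun_prop)]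
    calc ENNReal.ofReal (t ^ b) * ∫⁻ w in W, ‖fderiv ℝ f (x + t • (w - x))‖ₑ ^ p ∂μ
        ≤ ENNReal.ofReal (t ^ b) * ∫⁻ w,
            B.indicator (fun w => ‖fderiv ℝ f w‖ₑ ^ p) (x + t • (w - x)) ∂μ := by
          refine mul_le_mul_right ?_ _
          rw [← lintegral_indicator hWm]
          refine lintegral_mono fun w => ?_
          by_cases hw : w ∈ W
          · rw [indicator_of_mem hw, indicator_of_mem
              (hBc.add_smul_sub_mem hx (hWB hw) ⟨ht.1.le, ht.2⟩)]
          · simp [hw]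
      _ = _ := by
          rw [lintegral_comp_add_smul_sub μ hFm x ht.1, lintegral_indicator hBm, ← mul_assoc,
            ← ENNReal.ofReal_mul (Real.rpow_nonneg ht.1.le _), Real.rpow_sub ht.1,
            Real.rpow_natCast, div_eq_mul_inv]
  calc ∫⁻ w in W, ‖f w - f x‖ₑ ^ p ∂μ
      ≤ ∫⁻ w in W, K * ENNReal.ofReal r ^ p * (∫⁻ t in Ioc (0 : ℝ) 1,
          ENNReal.ofReal (t ^ b) * ‖fderiv ℝ f (x + t • (w - x))‖ₑ ^ p) ∂μ :=
        setLIntegral_mono' hWm hpoint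
    _ = K * ENNReal.ofReal r ^ p * ∫⁻ t in Ioc (0 : ℝ) 1, ∫⁻ w in W,
          ENNReal.ofReal (t ^ b) * ‖fderiv ℝ f (x + t • (w - x))‖ₑ ^ p ∂μ := by
        rw [lintegral_const_mul, lintegral_lintegral_swap]
        · fun_prop
        · exact Measurable.lintegral_prod_right (by fun_prop)
    _ ≤ K * ENNReal.ofReal r ^ p * ∫⁻ t in Ioc (0 : ℝ) 1,
          ENNReal.ofReal (t ^ (b - d)) * ∫⁻ w in B, ‖fderiv ℝ f w‖ₑ ^ p ∂μ := by
        gcongr K * ENNReal.ofReal r ^ p * ?_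
        exact setLIntegral_mono' measurableSet_Ioc hscale
    _ = _ := by
        rw [lintegral_mul_const _ (by fun_prop)]
        ring

/-- Morrey's inequality on the closed ball of radius two. -/
lemma exists_enorm_sub_rpow_le_morrey {p : ℝ} (hp : 1 < p)
    (hd : (Module.finrank ℝ E : ℝ) < p) :
    ∃ C : ℝ≥0∞, C ≠ ⊤ ∧ ∀ f : E → ℝ, ContDiff ℝ 1 f → ∀ x ∈ closedBall (0 : E) 2,
      ∀ y ∈ closedBall (0 : E) 2, ‖f x - f y‖ₑ ^ p ≤
        C * ENNReal.ofReal (‖x - y‖ ^ (p - Module.finrank ℝ E)) *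
          ∫⁻ w in closedBall 0 2, ‖fderiv ℝ f w‖ₑ ^ p ∂μ := by
  obtain ⟨K, hK, hKle⟩ := exists_setLIntegral_enorm_sub_rpow_le μ hp hd
  set d := Module.finrank ℝ E with hd_def
  have hp0 : 0 < p := by linarith
  set v : ℝ≥0∞ := ENNReal.ofReal ((1 / 4) ^ d) * μ (closedBall 0 1) with hv
  have hv0 : v ≠ 0 := mul_ne_zero (by simp)
    (measure_closedBall_pos μ _ one_pos).ne'
  have hvt : v ≠ ⊤ := ENNReal.mul_ne_top ENNReal.ofReal_ne_top measure_closedBall_lt_top.ne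
  refine ⟨v⁻¹ * (2 ^ (p - 1) * (2 * K)), ?_, ?_⟩
  · refine ENNReal.mul_ne_top (ENNReal.inv_ne_top.2 hv0) (ENNReal.mul_ne_top ?_
      (ENNReal.mul_ne_top (by simp) hK))
    exact ENNReal.rpow_ne_top_of_nonneg (by linarith) (by simp)
  intro f hf x hx y hy
  rcases eq_or_ne x y with rfl | hxy
  · simp [hp0]
  set r := ‖x - y‖ with hr
  have hr0 : 0 < r := norm_pos_iff.2 (sub_ne_zero.2 hxy)
  obtain ⟨c, hcB, hcr⟩ := exists_closedBall_subset_closedBall_two hx hy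
  set W := closedBall c (r / 4) with hW
  set I := ∫⁻ w in closedBall 0 2, ‖fderiv ℝ f w‖ₑ ^ p ∂μ with hI
  have hosc : ∀ a ∈ closedBall (0 : E) 2, (∀ w ∈ W, ‖w - a‖ ≤ r) →
      ∫⁻ w in W, ‖f w - f a‖ₑ ^ p ∂μ ≤ K * ENNReal.ofReal r ^ p * I := fun a ha har =>
    hKle f hf _ W (convex_closedBall _ _) measurableSet_closedBall measurableSet_closedBall hcB
      a ha r har
  have hμW : μ W = ENNReal.ofReal (r ^ d) * v := by
    rw [hW, Measure.addHaar_closedBall' μ _ (by positivity), hv, ← mul_assoc,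
      ← ENNReal.ofReal_mul (by positivity), ← mul_pow, mul_one_div]
  have hfc : Continuous f := hf.continuous
  have hmean : ENNReal.ofReal (r ^ d) * v * ‖f x - f y‖ₑ ^ p ≤
      2 ^ (p - 1) * (2 * K) * ENNReal.ofReal r ^ p * I := by
    calc ENNReal.ofReal (r ^ d) * v * ‖f x - f y‖ₑ ^ p
        = ∫⁻ _ in W, ‖f x - f y‖ₑ ^ p ∂μ := by rw [setLIntegral_const, hμW, mul_comm]
      _ ≤ ∫⁻ w in W, 2 ^ (p - 1) * (‖f w - f x‖ₑ ^ p + ‖f w - f y‖ₑ ^ p) ∂μ := by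
          refine lintegral_mono fun w => ?_
          refine le_trans ?_ (ENNReal.rpow_add_le_mul_rpow_add_rpow _ _ hp.le)
          gcongr
          rw [← enorm_neg (f w - f x)]
          refine le_of_eq_of_le ?_ (enorm_add_le _ _)
          congr 1
          ring
      _ = 2 ^ (p - 1) *
            (∫⁻ w in W, ‖f w - f x‖ₑ ^ p ∂μ + ∫⁻ w in W, ‖f w - f y‖ₑ ^ p ∂μ) := by
          rw [lintegral_const_mul _ (by fun_prop), lintegral_add_left (by fun_prop)]
      _ ≤ 2 ^ (p - 1) * (K * ENNReal.ofReal r ^ p * I + K * ENNReal.ofReal r ^ p * I) := by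
          gcongr
          · exact hosc x hx fun w hw => (hcr w hw).1
          · exact hosc y hy fun w hw => (hcr w hw).2
      _ = _ := by ring
  have hrd0 : ENNReal.ofReal (r ^ d) ≠ 0 := by simp; positivity
  have hsplit : ENNReal.ofReal r ^ p = ENNReal.ofReal (r ^ d) * ENNReal.ofReal (r ^ (p - d)) := by
    rw [← ENNReal.ofReal_mul (by positivity), ENNReal.ofReal_rpow_of_pos hr0, ← Real.rpow_natCast,
      ← Real.rpow_add hr0, add_sub_cancel]
  rw [hsplit] at hmean
  rw [← ENNReal.mul_le_mul_iff_right hrd0 ENNReal.ofReal_ne_top,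
    ← ENNReal.mul_le_mul_iff_right hv0 hvt]
  calc v * (ENNReal.ofReal (r ^ d) * ‖f x - f y‖ₑ ^ p)
      = ENNReal.ofReal (r ^ d) * v * ‖f x - f y‖ₑ ^ p := by ring
    _ ≤ _ := hmean
    _ = v * v⁻¹ * (2 ^ (p - 1) * (2 * K) *
          (ENNReal.ofReal (r ^ d) * ENNReal.ofReal (r ^ (p - d))) * I) := by
        rw [ENNReal.mul_inv_cancel hv0 hvt, one_mul]
    _ = _ := by ring

end Morrey

/-- Restricting to a slice does not increase the norm of the derivative. -/
lemma enorm_fderiv_slice_le {E F : Type*} [NormedAddCommGroup E] [NormedSpace ℝ E]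
    [NormedAddCommGroup F] [NormedSpace ℝ F] {u : E × F → ℝ} {x : E} {z : F}
    (hu : DifferentiableAt ℝ u (x, z)) :
    ‖fderiv ℝ (fun x => u (x, z)) x‖ₑ ≤ ‖fderiv ℝ u (x, z)‖ₑ := by
  have h : HasFDerivAt (fun x => u (x, z))
      ((fderiv ℝ u (x, z)).comp (ContinuousLinearMap.inl ℝ E F)) x :=
    hu.hasFDerivAt.comp x (hasFDerivAt_prodMk_left x z)
  rw [h.fderiv, enorm_le_iff_norm_le]
  refine ((fderiv ℝ u (x, z)).opNorm_comp_le _).trans ?_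
  exact mul_le_of_le_one_right (norm_nonneg _) (ContinuousLinearMap.norm_inl_le_one ℝ E F)

/-- Banach-space-valued Morrey embedding
`W^{1,p}(B₂ × N) ⊂ C^{0,λ}(B₂, L^p(N))`, `λ = 1 − m/p`: for `p > m` there is a
constant `C = C(m,n,p)` such that every `C¹` function `u : ℝ^m × ℝ^n → ℝ`
satisfies, for all `x, y ∈ B₂`,
`∫_N |u(x,z) − u(y,z)|^p dz ≤ C |x−y|^{p−m} ∫_{B₂×N} (|u|^p + ‖Du‖^p)`. -/
theorem stmt_1 (m n : ℕ) (hm : 1 ≤ m) (hn : 1 ≤ n) (p : ℝ)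
    (hpm : (m : ℝ) < p) :
    ∃ C : ℝ, ∀ u : EuclideanSpace ℝ (Fin m) × EuclideanSpace ℝ (Fin n) → ℝ,
      ContDiff ℝ 1 u →
      ∀ x ∈ closedBall (0 : EuclideanSpace ℝ (Fin m)) 2,
      ∀ y ∈ closedBall (0 : EuclideanSpace ℝ (Fin m)) 2,
        (∫ z in closedBall (0 : EuclideanSpace ℝ (Fin n)) 1,
            |u (x, z) - u (y, z)| ^ p) ≤
          C * ‖x - y‖ ^ (p - m) *
            ∫ w in (closedBall (0 : EuclideanSpace ℝ (Fin m)) 2) ×ˢ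
                (closedBall (0 : EuclideanSpace ℝ (Fin n)) 1),
              |u w| ^ p + ‖fderiv ℝ u w‖ ^ p := by
  have hm1 : (1 : ℝ) ≤ m := by exact_mod_cast hm
  have hp1 : 1 < p := by linarith
  have hp0 : 0 < p := by linarith
  have hdim : Module.finrank ℝ (EuclideanSpace ℝ (Fin m)) = m := by simp
  obtain ⟨C, hC, hCle⟩ := exists_enorm_sub_rpow_le_morrey
    (volume : Measure (EuclideanSpace ℝ (Fin m))) hp1 (by rwa [hdim])
  rw [hdim] at hCle
  refine ⟨C.toReal, fun u hu x hx y hy => ?_⟩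
  have huc : Continuous u := hu.continuous
  have hdu : Continuous (fderiv ℝ u) := hu.continuous_fderiv one_ne_zero
  set B := closedBall (0 : EuclideanSpace ℝ (Fin m)) 2 with hB
  set N := closedBall (0 : EuclideanSpace ℝ (Fin n)) 1 with hN
  have hrhs : Continuous fun w => |u w| ^ p + ‖fderiv ℝ u w‖ ^ p :=
    (huc.abs.rpow_const fun _ => Or.inr hp0.le).add (hdu.norm.rpow_const fun _ => Or.inr hp0.le)
  have hint : IntegrableOn (fun w => |u w| ^ p + ‖fderiv ℝ u w‖ ^ p) (B ×ˢ N) :=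
    hrhs.continuousOn.integrableOn_compact
      ((isCompact_closedBall _ _).prod (isCompact_closedBall _ _))
  have hslice : ∫⁻ z in N, ‖u (x, z) - u (y, z)‖ₑ ^ p ≤
      C * ENNReal.ofReal (‖x - y‖ ^ (p - m)) *
        ∫⁻ w in B ×ˢ N, ENNReal.ofReal (|u w| ^ p + ‖fderiv ℝ u w‖ ^ p) := by
    calc ∫⁻ z in N, ‖u (x, z) - u (y, z)‖ₑ ^ p
        ≤ ∫⁻ z in N, C * ENNReal.ofReal (‖x - y‖ ^ (p - m)) *
            ∫⁻ ξ in B, ‖fderiv ℝ u (ξ, z)‖ₑ ^ p := by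
          refine lintegral_mono fun z => ?_
          refine (hCle (fun ξ => u (ξ, z)) (hu.comp (by fun_prop)) x hx y hy).trans ?_
          gcongr with ξ
          exact enorm_fderiv_slice_le (hu.differentiable one_ne_zero _)
      _ = C * ENNReal.ofReal (‖x - y‖ ^ (p - m)) *
            ∫⁻ w in B ×ˢ N, ‖fderiv ℝ u w‖ₑ ^ p := by
          rw [lintegral_const_mul _ (Measurable.lintegral_prod_left (by fun_prop)),
            Measure.volume_eq_prod, ← Measure.prod_restrict, lintegral_prod_symm _ (by fun_prop)]
      _ ≤ _ := by
          gcongr with w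
          rw [← ofReal_norm, ENNReal.ofReal_rpow_of_nonneg (norm_nonneg _) hp0.le]
          exact ENNReal.ofReal_le_ofReal (le_add_of_nonneg_left (by positivity))
  have hlhs : ∫ z in N, |u (x, z) - u (y, z)| ^ p =
      (∫⁻ z in N, ‖u (x, z) - u (y, z)‖ₑ ^ p).toReal := by
    rw [integral_eq_lintegral_of_nonneg_ae (.of_forall fun z => by positivity)]
    · congr 1
      refine lintegral_congr fun z => ?_
      rw [← ofReal_norm, ENNReal.ofReal_rpow_of_nonneg (norm_nonneg _) hp0.le, Real.norm_eq_abs]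
    · exact Continuous.aestronglyMeasurable
        (Continuous.rpow_const (by fun_prop) fun _ => Or.inr hp0.le)
  rw [hlhs, integral_eq_lintegral_of_nonneg_ae (.of_forall fun w => by positivity)
    hrhs.aestronglyMeasurable]
  refine (ENNReal.toReal_mono ?_ hslice).trans_eq ?_
  · exact ENNReal.mul_ne_top (ENNReal.mul_ne_top hC ENNReal.ofReal_ne_top)
      hint.lintegral_lt_top.ne
  · rw [ENNReal.toReal_mul, ENNReal.toReal_mul, ENNReal.toReal_ofReal (by positivity)]
end

section
/- Let (U, μ) and (Σ, ν) be σ-finite measure spaces, let f : U × Σ → [0, ∞] be measurable, and let t, r, α be real numbers with 1 ≤ t < 2, r > t and α > t. Set σ = 2(α − t)/(2 − t) and ρ = r(α − t)/(r − t). Then ∫_U ∫_Σ f(x,y)^α dν(y) dμ(x) ≤ ‖f‖_{L^r(U, L²(Σ))}^t · ‖f‖_{L^ρ(U, L^σ(Σ))}^{α − t}. -/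
open MeasureTheory ENNReal

/-- Hölder's inequality with exponents `s / t` and `s / (s - t)`. -/
theorem lintegral_rpow_mul_rpow_le {X : Type*} [MeasurableSpace X] (μ : Measure X)
    {f g : X → ℝ≥0∞} (hf : AEMeasurable f μ) (hg : AEMeasurable g μ)
    {s t u : ℝ} (ht : 0 < t) (hts : t < s) :
    ∫⁻ x, f x ^ t * g x ^ u ∂μ ≤
      (∫⁻ x, f x ^ s ∂μ) ^ (t / s) *
        (∫⁻ x, g x ^ (s * u / (s - t)) ∂μ) ^ ((s - t) / s) := by
  have hs : 0 < s := ht.trans hts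
  have hst : 0 < s - t := sub_pos.2 hts
  have hpq : (s / t).HolderConjugate (s / (s - t)) := by
    rw [Real.holderConjugate_iff]
    refine ⟨(one_lt_div ht).2 hts, ?_⟩
    field_simp
    ring
  have h := lintegral_mul_le_Lp_mul_Lq μ hpq (hf.pow_const t) (hg.pow_const u)
  have e₁ : t * (s / t) = s := by field_simp
  have e₂ : u * (s / (s - t)) = s * u / (s - t) := by ring
  simpa only [Pi.mul_apply, ← ENNReal.rpow_mul, e₁, e₂, one_div_div] using h

/-- Mixed-norm Hölder interpolation: for σ-finite measure spaces `(U, μ)`,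
`(Σ, ν)`, a measurable `f : U × Σ → [0,∞]`, and reals `1 ≤ t < 2`, `r > t`,
`α > t`, setting `σ = 2(α − t)/(2 − t)` and `ρ = r(α − t)/(r − t)`, one has
`∫_U ∫_Σ f^α ≤ ‖f‖_{L^r(U,L²(Σ))}^t · ‖f‖_{L^ρ(U,L^σ(Σ))}^(α−t)`. -/
theorem stmt_12 {U S : Type*} [MeasurableSpace U] [MeasurableSpace S]
    (μ : Measure U) (ν : Measure S) [SigmaFinite μ] [SigmaFinite ν]
    (f : U × S → ℝ≥0∞) (hf : Measurable f)
    (t r α σ ρ : ℝ) (ht1 : 1 ≤ t) (ht2 : t < 2) (hr : t < r) (hα : t < α)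
    (hσ : σ = 2 * (α - t) / (2 - t)) (hρ : ρ = r * (α - t) / (r - t)) :
    ∫⁻ x, ∫⁻ y, f (x, y) ^ α ∂ν ∂μ ≤
      ((∫⁻ x, (∫⁻ y, f (x, y) ^ (2 : ℝ) ∂ν) ^ (r / 2) ∂μ) ^ (1 / r)) ^ t *
      ((∫⁻ x, (∫⁻ y, f (x, y) ^ σ ∂ν) ^ (ρ / σ) ∂μ) ^ (1 / ρ)) ^ (α - t) := by
  have ht0 : 0 < t := one_pos.trans_le ht1
  have hr0 : 0 < r := ht0.trans hr
  have h2t : 0 < 2 - t := sub_pos.2 ht2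
  have hrt : 0 < r - t := sub_pos.2 hr
  have hαt : 0 < α - t := sub_pos.2 hα
  have hσ' : 1 / σ * (α - t) = (2 - t) / 2 := by rw [hσ]; field_simp
  have hρ' : 1 / ρ * (α - t) = (r - t) / r := by rw [hρ]; field_simp
  have hmeas (p q : ℝ) : Measurable fun x => (∫⁻ y, f (x, y) ^ p ∂ν) ^ q :=
    ((hf.pow_const p).lintegral_prod_right').pow_const q
  have inner_le (x : U) : ∫⁻ y, f (x, y) ^ α ∂ν ≤
      ((∫⁻ y, f (x, y) ^ (2 : ℝ) ∂ν) ^ (1 / 2 : ℝ)) ^ t *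
        ((∫⁻ y, f (x, y) ^ σ ∂ν) ^ (1 / σ)) ^ (α - t) := by
    have hfx : AEMeasurable (fun y => f (x, y)) ν :=
      (hf.comp measurable_prodMk_left).aemeasurable
    have h := lintegral_rpow_mul_rpow_le ν hfx hfx (u := α - t) ht0 ht2
    simp only [← ENNReal.rpow_add_of_nonneg _ _ ht0.le hαt.le, add_sub_cancel, ← hσ] at h
    rwa [← ENNReal.rpow_mul, ← ENNReal.rpow_mul, hσ', one_div_mul_eq_div]
  refine (lintegral_mono inner_le).trans ?_
  have h := lintegral_rpow_mul_rpow_le μ (hmeas 2 (1 / 2)).aemeasurable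
    (hmeas σ (1 / σ)).aemeasurable (u := α - t) ht0 hr
  rw [← hρ] at h
  rw [← ENNReal.rpow_mul _ (1 / r), ← ENNReal.rpow_mul _ (1 / ρ), hρ', one_div_mul_eq_div]
  refine h.trans_eq ?_
  simp only [← ENNReal.rpow_mul, one_div_mul_eq_div]
end

section
/- Let (U, μ) and (Σ, ν) be σ-finite measure spaces, let f : U × Σ → [0, ∞] be measurable, and let t, r, α be real numbers with 1 ≤ t < 2, r > t and α > t. Set σ = 2(α − t)/(2 − t) and ρ = r(α − t)/(r − t). Then ∫_U ∫_Σ f(x,y)^α dν(y) dμ(x) ≤ ‖f‖_{L^r(U, L²(Σ))}^α + ‖f‖_{L^ρ(U, L^σ(Σ))}^α. -/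
open MeasureTheory ENNReal

/-- A product of powers is bounded by the sum of the powers of the total exponent. -/
theorem ENNReal.rpow_mul_rpow_le_rpow_add_rpow (a b : ℝ≥0∞) {s t : ℝ} (hs : 0 ≤ s) (ht : 0 ≤ t) :
    a ^ s * b ^ t ≤ a ^ (s + t) + b ^ (s + t) := by
  rcases le_total a b with h | h
  · calc a ^ s * b ^ t ≤ b ^ s * b ^ t := by gcongr
      _ = b ^ (s + t) := (ENNReal.rpow_add_of_nonneg s t hs ht).symm
      _ ≤ _ := le_add_self
  · calc a ^ s * b ^ t ≤ a ^ s * a ^ t := by gcongr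
      _ = a ^ (s + t) := (ENNReal.rpow_add_of_nonneg s t hs ht).symm
      _ ≤ _ := le_self_add

/-- Mixed-norm interpolation inequality behind the inclusion
`W^{1,r}(Ũ, L²(Σ)) ∩ W^{1,q}(Ũ, L^s(Σ)) ⊂ W^{1,α}(Ũ, L^α(Σ))`: for σ-finite
measure spaces `(U, μ)`, `(Σ, ν)`, a measurable `f : U × Σ → [0,∞]`, and reals
`1 ≤ t < 2`, `r > t`, `α > t`, with `σ = 2(α − t)/(2 − t)` and
`ρ = r(α − t)/(r − t)`, one has
`∫_U ∫_Σ f^α ≤ ‖f‖_{L^r(U,L²(Σ))}^α + ‖f‖_{L^ρ(U,L^σ(Σ))}^α`. -/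
theorem stmt_13 {U S : Type*} [MeasurableSpace U] [MeasurableSpace S]
    (μ : Measure U) (ν : Measure S) [SigmaFinite μ] [SigmaFinite ν]
    (f : U × S → ℝ≥0∞) (hf : Measurable f)
    (t r α σ ρ : ℝ) (ht1 : 1 ≤ t) (ht2 : t < 2) (hr : t < r) (hα : t < α)
    (hσ : σ = 2 * (α - t) / (2 - t)) (hρ : ρ = r * (α - t) / (r - t)) :
    ∫⁻ x, ∫⁻ y, f (x, y) ^ α ∂ν ∂μ ≤
      ((∫⁻ x, (∫⁻ y, f (x, y) ^ (2 : ℝ) ∂ν) ^ (r / 2) ∂μ) ^ (1 / r)) ^ α +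
      ((∫⁻ x, (∫⁻ y, f (x, y) ^ σ ∂ν) ^ (ρ / σ) ∂μ) ^ (1 / ρ)) ^ α := by
  have h2t : 0 < 2 - t := sub_pos.2 ht2
  have hrt : 0 < r - t := sub_pos.2 hr
  have hαt : 0 < α - t := sub_pos.2 hα
  have ht0 : 0 < t := by linarith
  have hr0 : 0 < r := ht0.trans hr
  have hσ_exp : σ * ((2 - t) / 2) = α - t := by rw [hσ]; field_simp
  have hρσ_exp : ρ / σ * ((r - t) / r) = (2 - t) / 2 := by rw [hσ, hρ]; field_simp
  have hρ_exp : 1 / ρ * (α - t) = (r - t) / r := by rw [hρ]; field_simp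
  have hA : Measurable fun x => ∫⁻ y, f (x, y) ^ (2 : ℝ) ∂ν :=
    (hf.pow_const _).lintegral_prod_right'
  have hB : Measurable fun x => ∫⁻ y, f (x, y) ^ σ ∂ν :=
    (hf.pow_const _).lintegral_prod_right'
  calc ∫⁻ x, ∫⁻ y, f (x, y) ^ α ∂ν ∂μ
      = ∫⁻ x, ∫⁻ y, (f (x, y) ^ (2 : ℝ)) ^ (t / 2) * (f (x, y) ^ σ) ^ ((2 - t) / 2) ∂ν ∂μ := by
        refine lintegral_congr fun x => lintegral_congr fun y => ?_
        rw [← ENNReal.rpow_mul, ← ENNReal.rpow_mul, hσ_exp, mul_div_cancel₀ t two_ne_zero,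
          ← ENNReal.rpow_add_of_nonneg _ _ ht0.le hαt.le, add_sub_cancel]
    _ ≤ ∫⁻ x, (∫⁻ y, f (x, y) ^ (2 : ℝ) ∂ν) ^ (t / 2) *
          (∫⁻ y, f (x, y) ^ σ ∂ν) ^ ((2 - t) / 2) ∂μ := by
        refine lintegral_mono fun x => ?_
        have hfx : Measurable fun y => f (x, y) := hf.comp measurable_prodMk_left
        exact ENNReal.lintegral_mul_norm_pow_le (hfx.pow_const _).aemeasurable
          (hfx.pow_const _).aemeasurable (by positivity) (by positivity) (by ring)
    _ = ∫⁻ x, ((∫⁻ y, f (x, y) ^ (2 : ℝ) ∂ν) ^ (r / 2)) ^ (t / r) *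
          ((∫⁻ y, f (x, y) ^ σ ∂ν) ^ (ρ / σ)) ^ ((r - t) / r) ∂μ := by
        refine lintegral_congr fun x => ?_
        rw [← ENNReal.rpow_mul, ← ENNReal.rpow_mul, hρσ_exp,
          show r / 2 * (t / r) = t / 2 by field_simp]
    _ ≤ (∫⁻ x, (∫⁻ y, f (x, y) ^ (2 : ℝ) ∂ν) ^ (r / 2) ∂μ) ^ (t / r) *
          (∫⁻ x, (∫⁻ y, f (x, y) ^ σ ∂ν) ^ (ρ / σ) ∂μ) ^ ((r - t) / r) :=
        ENNReal.lintegral_mul_norm_pow_le (hA.pow_const _).aemeasurable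
          (hB.pow_const _).aemeasurable (by positivity) (by positivity) (by field_simp; ring)
    _ = ((∫⁻ x, (∫⁻ y, f (x, y) ^ (2 : ℝ) ∂ν) ^ (r / 2) ∂μ) ^ (1 / r)) ^ t *
          ((∫⁻ x, (∫⁻ y, f (x, y) ^ σ ∂ν) ^ (ρ / σ) ∂μ) ^ (1 / ρ)) ^ (α - t) := by
        rw [← ENNReal.rpow_mul, ← ENNReal.rpow_mul, hρ_exp, one_div_mul_eq_div]
    _ ≤ _ := by
        simpa only [add_sub_cancel] using
          ENNReal.rpow_mul_rpow_le_rpow_add_rpow _ _ ht0.le hαt.le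
end
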